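/- arXiv:1305.4003 — 5 statements merged into one kernel-verified Lean document; each statement's English description precedes it below -/
import Mathlib

section
/- Let k be a field, Λ a k-algebra, I an index type, and (C_i)_{i ∈ I} a family of Λ-modules. Let X_1, …, X_n be finitely many Λ-modules, each finite-dimensional as a k-vector space. Then there exist m ∈ ℕ and τ : Fin m → I such that for all indices s, t ∈ {1,…,n}, every Λ-linear map f : X_s → X_t that factors through add 𝒞 already factors through the single module ∏_{j<m} C_{τ(j)}, i.e. there are Λ-linear maps h : X_s → ∏_{j<m} C_{τ(j)} and g : ∏_{j<m} C_{τ(j)} → X_t with f = g ∘ h. -/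
open LinearMap in
/-- A finite sum of maps, each of which factors through a member of a family indexed by an
injection into `J`, factors through the product over `J`. -/
theorem exists_comp_pi_of_eq_sum {Λ J A X Y : Type*} [Ring Λ] [Finite J] [Fintype A]
    {D : J → Type*} [∀ j, AddCommGroup (D j)] [∀ j, Module Λ (D j)]
    [AddCommGroup X] [Module Λ X] [AddCommGroup Y] [Module Λ Y]
    {e : A → J} (he : Function.Injective e)
    (h : ∀ a, X →ₗ[Λ] D (e a)) (g : ∀ a, D (e a) →ₗ[Λ] Y) :
    ∃ (h' : X →ₗ[Λ] ∀ j, D j) (g' : (∀ j, D j) →ₗ[Λ] Y),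
      ∑ a, (g a).comp (h a) = g'.comp h' := by
  classical
  refine ⟨∑ a, (single Λ D (e a)).comp (h a), ∑ a, (g a).comp (proj (e a)), ?_⟩
  ext x
  simp only [LinearMap.sum_apply, comp_apply, proj_apply]
  refine Finset.sum_congr rfl fun a _ => ?_
  rw [Finset.sum_apply, Finset.sum_eq_single a]
  · simp
  · intro b _ hb
    simp [Pi.single_eq_of_ne (he.ne hb.symm)]
  · simp

/-- For a `k`-algebra `Λ`, the space of `Λ`-linear maps between finite-dimensional modules is
finite-dimensional. -/
theorem finiteDimensional_linearMap_of_algebra (k Λ X Y : Type*) [Field k] [Ring Λ] [Algebra k Λ]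
    [AddCommGroup X] [Module Λ X] [Module k X] [IsScalarTower k Λ X] [FiniteDimensional k X]
    [AddCommGroup Y] [Module Λ Y] [Module k Y] [IsScalarTower k Λ Y] [FiniteDimensional k Y] :
    FiniteDimensional k (X →ₗ[Λ] Y) :=
  Module.Finite.of_injective (LinearMap.restrictScalarsₗ k Λ X Y k)
    (LinearMap.restrictScalars_injective k)


/-- **Lemma 1.** Given finitely many finite-dimensional modules `X 1, …, X n` and a family
`𝒞 = (C i)` of `Λ`-modules, there is a single module `∏_{j < m} C (τ j)` in `add 𝒞` such that
every map `X s → X t` factoring through `add 𝒞` factors through it. -/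
theorem stmt_0 (k : Type*) [Field k] (Λ : Type*) [Ring Λ] [Algebra k Λ]
    (I : Type*) (C : I → Type*) [∀ i, AddCommGroup (C i)] [∀ i, Module Λ (C i)]
    (n : ℕ) (X : Fin n → Type*) [∀ s, AddCommGroup (X s)] [∀ s, Module Λ (X s)]
    [∀ s, Module k (X s)] [∀ s, IsScalarTower k Λ (X s)]
    [∀ s, FiniteDimensional k (X s)] :
    ∃ (m : ℕ) (τ : Fin m → I), ∀ (s t : Fin n) (f : X s →ₗ[Λ] X t),
      (∃ (m' : ℕ) (τ' : Fin m' → I) (h : X s →ₗ[Λ] ∀ j : Fin m', C (τ' j))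
        (g : (∀ j : Fin m', C (τ' j)) →ₗ[Λ] X t), f = g.comp h) →
      ∃ (h : X s →ₗ[Λ] ∀ j : Fin m, C (τ j)) (g : (∀ j : Fin m, C (τ j)) →ₗ[Λ] X t),
        f = g.comp h := by
  classical
  let S (p : Fin n × Fin n) : Set (X p.1 →ₗ[Λ] X p.2) :=
    {f | ∃ (i : I) (h : X p.1 →ₗ[Λ] C i) (g : C i →ₗ[Λ] X p.2), f = g.comp h}
  have exists_finset (p : Fin n × Fin n) : ∃ T : Finset (X p.1 →ₗ[Λ] X p.2),
      ↑T ⊆ S p ∧ Submodule.span k (S p) = Submodule.span k T := by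
    have := finiteDimensional_linearMap_of_algebra k Λ (X p.1) (X p.2)
    exact Submodule.fg_span_iff_fg_span_finset_subset (S p) |>.1 (IsNoetherian.noetherian _)
  choose T hTS hT using exists_finset
  choose i h g hgh using fun (p : Fin n × Fin n) (b : T p) => hTS p b.2
  let σ : (Σ p, T p) → I := fun a => i a.1 a.2
  let ε := (Fintype.equivFin (Σ p, T p)).symm
  let E := LinearEquiv.piCongrLeft Λ (fun a => C (σ a)) ε
  refine ⟨_, σ ∘ ε, ?_⟩
  rintro s t f ⟨m', τ', u, v, rfl⟩
  have hmem : v.comp u ∈ Submodule.span k (S (s, t)) := by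
    have hsum : v.comp u = ∑ j, (v.comp (LinearMap.single Λ _ j)).comp
        ((LinearMap.proj j).comp u) := by
      ext x
      simp [← map_sum, Finset.univ_sum_single]
    rw [hsum]
    exact Submodule.sum_mem _ fun j _ => Submodule.subset_span ⟨τ' j, _, _, rfl⟩
  rw [hT, Submodule.mem_span_finset'] at hmem
  obtain ⟨c, hc⟩ := hmem
  obtain ⟨h', g', hg'⟩ := exists_comp_pi_of_eq_sum (D := fun a => C (σ a))
    (e := Sigma.mk (β := fun p => T p) (s, t)) sigma_mk_injective
    (h (s, t)) (fun b => c b • g (s, t) b)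
  refine ⟨E.symm.toLinearMap.comp h', g'.comp E.toLinearMap, ?_⟩
  have hE : (g'.comp E.toLinearMap).comp (E.symm.toLinearMap.comp h') = g'.comp h' := by
    ext x
    simp
  rw [← hc]
  refine Eq.trans (Finset.sum_congr rfl fun b _ => ?_) (hg'.trans hE.symm)
  rw [LinearMap.smul_comp, ← hgh]
end

section
/- Let k be a field, R a k-algebra, e ∈ R an idempotent (e·e = e), and N an R-module that is finite-dimensional as a k-vector space. Let U be an R-submodule of N. Denote by eN the image of the k-linear map N → N, x ↦ e • x, and by eU the image of U under this map. If dim_k(eU) ≥ dim_k(eN), then the R-submodule of N generated by the set {e • x : x ∈ N} is contained in U. -/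
/-- Key step of Lemma 2: if `e` is an idempotent of `R` and `U ⊆ N` a submodule with
`dim_k eU ≥ dim_k eN`, then the `R`-submodule generated by `eN` is contained in `U`. -/
theorem stmt_4 (k : Type*) [Field k] (R : Type*) [Ring R] [Algebra k R]
    (e : R) (he : e * e = e)
    (N : Type*) [AddCommGroup N] [Module R N] [Module k N] [IsScalarTower k R N]
    [SMulCommClass R k N] [FiniteDimensional k N]
    (U : Submodule R N)
    (hdim : Module.finrank k (Submodule.map (DistribMulAction.toLinearMap k N e)
        (U.restrictScalars k)) ≥
      Module.finrank k (LinearMap.range (DistribMulAction.toLinearMap k N e))) :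
    Submodule.span R {y : N | ∃ x : N, y = e • x} ≤ U := by
  have heq := Submodule.eq_of_le_of_finrank_le
    (LinearMap.map_le_range (f := DistribSMul.toLinearMap k N e)
      (p := U.restrictScalars k)) hdim
  rw [Submodule.span_le]
  rintro _ ⟨x, rfl⟩
  have hx : e • x ∈ LinearMap.range (DistribSMul.toLinearMap k N e) := ⟨x, rfl⟩
  rw [← heq] at hx
  obtain ⟨u, hu, hux⟩ := hx
  rw [← hux]
  exact U.smul_mem e hu
end

section
/- Let k be an algebraically closed field and Λ a finite-dimensional local k-algebra whose set of non-units m satisfies m·m = 0 (a • (b • x) = 0 for all a, b ∈ m, x ∈ M). Let M be a Λ-module, finite-dimensional over k, let soc M = {x ∈ M : a • x = 0 for all a ∈ m}, and let U be a Λ-submodule of M with i := dim_k U ≤ dim_k(soc M). Then there exist a Λ-submodule U′ of M with U′ ⊆ soc M and dim_k U′ = i, and a function Φ assigning to each pair (λ₀, λ₁) ∈ k × k with (λ₀, λ₁) ≠ (0,0) a Λ-submodule Φ(λ₀, λ₁) of M, such that: dim_k Φ(λ₀, λ₁) = i for all (λ₀, λ₁) ≠ (0,0); Φ(1,0) = U;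 Φ(0,1) = U′; and Φ(cλ₀, cλ₁) = Φ(λ₀, λ₁) for every c ∈ k with c ≠ 0 (so Φ is a family of i-dimensional submodules parametrized by the projective line ℙ¹(k) joining U to a submodule of the socle). -/
/-- The socle `{x ∈ M | a • x = 0 for all non-units a}` of a module over a local algebra,
as a `k`-subspace. -/
def socSub (k Λ M : Type*) [Field k] [Ring Λ] [AddCommGroup M] [Module Λ M]
    [Module k M] [SMulCommClass Λ k M] : Submodule k M where
  carrier := {x | ∀ a : Λ, ¬ IsUnit a → a • x = 0}
  zero_mem' := fun a _ => smul_zero a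
  add_mem' := fun {x y} hx hy a ha => by rw [smul_add, hx a ha, hy a ha, add_zero]
  smul_mem' := fun c x hx a ha => by rw [smul_comm, hx a ha, smul_zero]

/-- Over an algebraically closed field, every element of a finite-dimensional algebra becomes a
non-unit after subtracting a suitable scalar. -/
lemma exists_not_isUnit_sub_algebraMap (k : Type*) [Field k] [IsAlgClosed k] {Λ : Type*} [Ring Λ]
    [Nontrivial Λ] [Algebra k Λ] [FiniteDimensional k Λ] (a : Λ) :
    ∃ c : k, ¬ IsUnit (a - algebraMap k Λ c) := by
  obtain ⟨c, hc⟩ := spectrum.nonempty_of_isAlgClosed_of_finiteDimensional k a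
  refine ⟨c, fun h => hc ?_⟩
  simpa [spectrum.mem_resolventSet_iff] using h.neg

/-- A subspace lying between `U ⊓ soc M` and `U ⊔ soc M` is a `Λ`-submodule. -/
lemma smul_mem_of_inf_socSub_le {k : Type*} [Field k] [IsAlgClosed k]
    {Λ : Type*} [Ring Λ] [Algebra k Λ] [FiniteDimensional k Λ] [Nontrivial Λ]
    {M : Type*} [AddCommGroup M] [Module Λ M] [Module k M] [IsScalarTower k Λ M]
    [SMulCommClass Λ k M]
    (hsq : ∀ a b : Λ, ¬ IsUnit a → ¬ IsUnit b → ∀ x : M, a • b • x = 0)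
    (U : Submodule Λ M) {N : Submodule k M}
    (hle : U.restrictScalars k ⊓ socSub k Λ M ≤ N)
    (hge : N ≤ U.restrictScalars k ⊔ socSub k Λ M) (a : Λ) {x : M} (hx : x ∈ N) :
    a • x ∈ N := by
  obtain ⟨c, hc⟩ := exists_not_isUnit_sub_algebraMap k a
  have hax : a • x = c • x + (a - algebraMap k Λ c) • x := by
    rw [sub_smul, algebraMap_smul, add_sub_cancel]
  rw [hax]
  refine N.add_mem (N.smul_mem c hx) (hle ⟨?_, fun b hb => hsq b _ hb hc x⟩)
  obtain ⟨u, hu, s, hs, rfl⟩ := Submodule.mem_sup.1 (hge hx)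
  rw [smul_add, hs _ hc, add_zero]
  exact U.smul_mem _ hu

/-- Given subspaces `U` and `S` with `dim U ≤ dim S`, there are a complement `C` of `U ⊓ S` in `U`
and an injection `φ` of `C` into `S` such that each member of the pencil spanned by the inclusion
of `C` and `φ` maps `C` isomorphically onto a subspace independent from `U ⊓ S`. -/
lemma exists_pencil {k V : Type*} [Field k] [AddCommGroup V] [Module k V] [FiniteDimensional k V]
    (U S : Submodule k V) (hUS : Module.finrank k U ≤ Module.finrank k S) :
    ∃ (C : Submodule k V) (φ : C →ₗ[k] V), U ⊓ S ⊔ C = U ∧ LinearMap.range φ ≤ S ∧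
      ∀ p : k × k, p ≠ (0, 0) → Module.finrank k
        (U ⊓ S ⊔ LinearMap.range (p.1 • C.subtype + p.2 • φ) : Submodule k V) =
          Module.finrank k U := by
  obtain ⟨C₀, hC₀⟩ := exists_isCompl (U ⊓ S)
  have sup_eq (T : Submodule k V) (hT : U ⊓ S ≤ T) : U ⊓ S ⊔ C₀ ⊓ T = T := by
    rw [← sup_inf_assoc_of_le C₀ hT, hC₀.sup_eq_top, top_inf_eq]
  have finrank_sup (E : Submodule k V) (hE : E ≤ C₀) :
      Module.finrank k (U ⊓ S ⊔ E : Submodule k V) =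
        Module.finrank k (U ⊓ S : Submodule k V) + Module.finrank k E := by
    rw [← Submodule.finrank_sup_add_finrank_inf_eq, (hC₀.disjoint.mono_right hE).eq_bot,
      finrank_bot, add_zero]
  have hU := finrank_sup (C₀ ⊓ U) inf_le_left
  have hS := finrank_sup (C₀ ⊓ S) inf_le_left
  rw [sup_eq U inf_le_left] at hU
  rw [sup_eq S inf_le_right] at hS
  obtain ⟨ψ, hψ⟩ := finrank_le_iff_exists_linearMap.1
    (show Module.finrank k (C₀ ⊓ U : Submodule k V) ≤ Module.finrank k (C₀ ⊓ S : Submodule k V) by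
      omega)
  refine ⟨C₀ ⊓ U, (C₀ ⊓ S).subtype ∘ₗ ψ, sup_eq U inf_le_left, ?_, fun p hp => ?_⟩
  · rintro _ ⟨c, rfl⟩
    exact (ψ c).2.2
  rw [finrank_sup, hU, LinearMap.finrank_range_of_inj]
  · rw [← LinearMap.ker_eq_bot, LinearMap.ker_eq_bot']
    intro c hc
    have hc' : p.1 • (c : V) + p.2 • (ψ c : V) = 0 := hc
    have h₁ : p.1 • (c : V) = 0 := by
      refine Submodule.disjoint_def.1 hC₀.disjoint _ ⟨U.smul_mem _ c.2.2, ?_⟩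
        (C₀.smul_mem _ c.2.1)
      rw [eq_neg_of_add_eq_zero_left hc']
      exact S.neg_mem (S.smul_mem _ (ψ c).2.2)
    rw [h₁, zero_add] at hc'
    by_cases h : p.1 = 0
    · have hp₂ : p.2 ≠ 0 := fun h' => hp (Prod.ext h h')
      have : ψ c = 0 := Subtype.ext ((smul_eq_zero.1 hc').resolve_left hp₂)
      exact (map_eq_zero_iff ψ hψ).1 this
    · exact Subtype.ext ((smul_eq_zero.1 h₁).resolve_left h)
  · rintro _ ⟨c, rfl⟩
    exact C₀.add_mem (C₀.smul_mem _ c.2.1) (C₀.smul_mem _ (ψ c).2.1)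

/-- Central geometric claim of Proposition 2: over a local algebra with radical square zero,
every `i`-dimensional submodule `U` of `M` (with `i ≤ dim soc M`) lies on a `ℙ¹`-family of
`i`-dimensional submodules joining `U` to a submodule `U′` contained in the socle. -/
theorem stmt_9 (k : Type*) [Field k] [IsAlgClosed k]
    (Λ : Type*) [Ring Λ] [Algebra k Λ] [FiniteDimensional k Λ] [IsLocalRing Λ]
    (M : Type*) [AddCommGroup M] [Module Λ M] [Module k M] [IsScalarTower k Λ M]
    [SMulCommClass Λ k M] [FiniteDimensional k M]
    (hsq : ∀ a b : Λ, ¬ IsUnit a → ¬ IsUnit b → ∀ x : M, a • b • x = 0)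
    (U : Submodule Λ M) (i : ℕ)
    (hi : Module.finrank k (U.restrictScalars k) = i)
    (hile : i ≤ Module.finrank k (socSub k Λ M)) :
    ∃ (U' : Submodule Λ M) (Φ : k × k → Submodule Λ M),
      U'.restrictScalars k ≤ socSub k Λ M ∧
      Module.finrank k (U'.restrictScalars k) = i ∧
      (∀ p : k × k, p ≠ (0, 0) → Module.finrank k ((Φ p).restrictScalars k) = i) ∧
      Φ (1, 0) = U ∧
      Φ (0, 1) = U' ∧
      (∀ c : k, c ≠ 0 → ∀ p : k × k, p ≠ (0, 0) → Φ (c * p.1, c * p.2) = Φ p) := by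
  subst hi
  obtain ⟨C, φ, hC, hφ, hrank⟩ := exists_pencil (U.restrictScalars k) (socSub k Λ M) hile
  have hCU : C ≤ U.restrictScalars k := le_sup_right.trans hC.le
  let g (p : k × k) : C →ₗ[k] M := p.1 • C.subtype + p.2 • φ
  let N (p : k × k) : Submodule k M :=
    U.restrictScalars k ⊓ socSub k Λ M ⊔ LinearMap.range (g p)
  have hN (p : k × k) : N p ≤ U.restrictScalars k ⊔ socSub k Λ M := by
    refine sup_le (inf_le_left.trans le_sup_left) ?_
    rintro _ ⟨c, rfl⟩
    exact Submodule.add_mem_sup (Submodule.smul_mem _ _ (hCU c.2))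
      (Submodule.smul_mem _ _ (hφ ⟨c, rfl⟩))
  let Φ (p : k × k) : Submodule Λ M :=
    { N p with smul_mem' := fun a _ hx => smul_mem_of_inf_socSub_le hsq U le_sup_left (hN p) a hx }
  have hΦ (p : k × k) : (Φ p).restrictScalars k = N p := rfl
  refine ⟨Φ (0, 1), Φ, ?_, ?_, fun p hp => hrank p hp, ?_, rfl, fun c hc p _ => ?_⟩
  · have : g (0, 1) = φ := by simp [g]
    rw [hΦ]
    exact sup_le inf_le_right (this ▸ hφ)
  · exact hrank (0, 1) (by simp)
  · have : g (1, 0) = C.subtype := by simp [g]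
    apply Submodule.restrictScalars_injective k
    rw [hΦ]
    simp only [N, this, Submodule.range_subtype, hC]
  · have : g (c * p.1, c * p.2) = c • g p := by simp only [g, smul_add, mul_smul]
    apply Submodule.restrictScalars_injective k
    rw [hΦ, hΦ]
    simp only [N, this, LinearMap.range_smul _ _ hc]
end

section
/- Let k be a field, Λ a k-algebra, and G, C Λ-modules. Let E = End_Λ(G × C) be the k-algebra of Λ-linear endomorphisms of G × C, and let e ∈ E be the idempotent projection (g, c) ↦ (0, c). Let I ⊆ End_Λ(G) be the set of Λ-linear endomorphisms of G that factor through a finite power of C (f ∈ I iff there exist n ∈ ℕ and Λ-linear maps h : G → Cⁿ, g′ : Cⁿ → G with f = g′ ∘ h). Then I is a two-sided ideal of End_Λ(G), and the map f ↦ π_G ∘ f ∘ ι_G (where ι_G : G → G × C is g ↦ (g,0) and π_G : G × C → G is (g,c) ↦ g) induces a k-algebra isomorphism from E modulo the two-sided ideal generated by e onto End_Λ(G)/I. -/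
section

variable {Λ : Type*} [Ring Λ] {G : Type*} [AddCommGroup G] [Module Λ G]
  {C : Type*} [AddCommGroup C] [Module Λ C]

/-- An endomorphism of `G` which factors through a finite power of `C`. -/
def FactorsThroughPower (C : Type*) [AddCommGroup C] [Module Λ C] (f : Module.End Λ G) : Prop :=
  ∃ (n : ℕ) (h : G →ₗ[Λ] (Fin n → C)) (g' : (Fin n → C) →ₗ[Λ] G), f = g'.comp h

namespace FactorsThroughPower

lemma of_comp (h : G →ₗ[Λ] C) (g' : C →ₗ[Λ] G) :
    FactorsThroughPower C (g'.comp h : Module.End Λ G) :=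
  ⟨1, LinearMap.pi fun _ => h, g'.comp (LinearMap.proj 0), rfl⟩

lemma of_fintype {ι : Type*} [Fintype ι] (h : G →ₗ[Λ] (ι → C)) (g' : (ι → C) →ₗ[Λ] G) :
    FactorsThroughPower C (g'.comp h : Module.End Λ G) := by
  let u := LinearEquiv.funCongrLeft Λ C (Fintype.equivFin ι)
  refine ⟨Fintype.card ι, u.symm.toLinearMap.comp h, g'.comp u.toLinearMap, ?_⟩
  ext x
  simp

lemma zero : FactorsThroughPower C (0 : Module.End Λ G) :=
  ⟨0, 0, 0, rfl⟩

lemma add {f₁ f₂ : Module.End Λ G} (h₁ : FactorsThroughPower C f₁)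
    (h₂ : FactorsThroughPower C f₂) : FactorsThroughPower C (f₁ + f₂) := by
  obtain ⟨m, a, b, rfl⟩ := h₁
  obtain ⟨n, c, d, rfl⟩ := h₂
  let u := LinearEquiv.sumArrowLequivProdArrow (Fin m) (Fin n) Λ C
  convert of_fintype (u.symm.toLinearMap.comp (a.prod c)) ((b.coprod d).comp u.toLinearMap) using 1
  ext x
  simp

lemma neg {f : Module.End Λ G} (hf : FactorsThroughPower C f) : FactorsThroughPower C (-f) := by
  obtain ⟨n, a, b, rfl⟩ := hf
  exact ⟨n, a, -b, (LinearMap.neg_comp _ _).symm⟩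

lemma mul_left (f₁ : Module.End Λ G) {f₂ : Module.End Λ G} (hf : FactorsThroughPower C f₂) :
    FactorsThroughPower C (f₁ * f₂) := by
  obtain ⟨n, a, b, rfl⟩ := hf
  exact ⟨n, a, f₁.comp b, rfl⟩

lemma mul_right {f₁ : Module.End Λ G} (f₂ : Module.End Λ G) (hf : FactorsThroughPower C f₁) :
    FactorsThroughPower C (f₁ * f₂) := by
  obtain ⟨n, a, b, rfl⟩ := hf
  exact ⟨n, a.comp f₂, b, rfl⟩

end FactorsThroughPower

variable (Λ G C)

/-- The two-sided ideal of endomorphisms of `G` factoring through a finite power of `C`. -/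
def factorIdeal : TwoSidedIdeal (Module.End Λ G) :=
  .mk' {f | FactorsThroughPower C f} .zero .add .neg (.mul_left _) (.mul_right _)

variable {Λ G C}

lemma mem_factorIdeal {f : Module.End Λ G} : f ∈ factorIdeal Λ G C ↔ FactorsThroughPower C f :=
  TwoSidedIdeal.mem_mk' ..

/-- The `G`-`G` corner of an endomorphism of `G × C`. -/
def corner (f : Module.End Λ (G × C)) : Module.End Λ G :=
  (LinearMap.fst Λ G C).comp (f.comp (LinearMap.inl Λ G C))

lemma corner_mul (f g : Module.End Λ (G × C)) :
    corner (f * g) = corner f * corner g +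
      (((LinearMap.fst Λ G C).comp (f.comp (LinearMap.inr Λ G C))).comp
        ((LinearMap.snd Λ G C).comp (g.comp (LinearMap.inl Λ G C))) : Module.End Λ G) := by
  ext x
  simp [corner, ← Prod.fst_add, ← map_add]

variable (Λ G C)

/-- The corner map, as a ring homomorphism to `End G` modulo the maps factoring through a finite
power of `C`. -/
def cornerHom : Module.End Λ (G × C) →+* (factorIdeal Λ G C).ringCon.Quotient where
  toFun f := (corner f : (factorIdeal Λ G C).ringCon.Quotient)
  map_one' := rfl
  map_zero' := rfl
  map_add' _ _ := rfl
  map_mul' f g := by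
    rw [← RingCon.coe_mul, RingCon.eq, TwoSidedIdeal.rel_iff, corner_mul, add_sub_cancel_left,
      mem_factorIdeal]
    exact .of_comp _ _

/-- The idempotent of `End (G × C)` projecting onto `C`. -/
def projC : Module.End Λ (G × C) := (LinearMap.inr Λ G C).comp (LinearMap.snd Λ G C)

variable {Λ G C}

lemma cornerHom_eq_zero_iff {f : Module.End Λ (G × C)} :
    cornerHom Λ G C f = 0 ↔ FactorsThroughPower C (corner f) := by
  rw [← mem_factorIdeal, TwoSidedIdeal.mem_iff, ← RingCon.eq]
  rfl

lemma inl_comp_comp_fst_mem_span {f : Module.End Λ G} (hf : FactorsThroughPower C f) :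
    ((LinearMap.inl Λ G C).comp (f.comp (LinearMap.fst Λ G C)) : Module.End Λ (G × C)) ∈
      TwoSidedIdeal.span {projC Λ G C} := by
  obtain ⟨n, h, g', rfl⟩ := hf
  let a (i : Fin n) : Module.End Λ (G × C) :=
    (LinearMap.inl Λ G C).comp ((g'.comp (LinearMap.single Λ _ i)).comp (LinearMap.snd Λ G C))
  let b (i : Fin n) : Module.End Λ (G × C) :=
    (LinearMap.inr Λ G C).comp (((LinearMap.proj i).comp h).comp (LinearMap.fst Λ G C))
  have key : ((LinearMap.inl Λ G C).comp ((g'.comp h).comp (LinearMap.fst Λ G C)) :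
      Module.End Λ (G × C)) = ∑ i, a i * projC Λ G C * b i := by
    refine LinearMap.ext fun x => ?_
    have hx : g' (h x.1) = ∑ i, g' (Pi.single i (h x.1 i)) := by
      rw [← map_sum, Finset.univ_sum_single]
    ext <;> simp [a, b, projC, LinearMap.sum_apply, Prod.fst_sum, Prod.snd_sum, hx]
  rw [key]
  exact sum_mem fun i _ => TwoSidedIdeal.mul_mem_right _ _ _ <| TwoSidedIdeal.mul_mem_left _ _ _ <|
    TwoSidedIdeal.subset_span rfl

lemma mem_span_projC_iff {f : Module.End Λ (G × C)} :
    f ∈ TwoSidedIdeal.span {projC Λ G C} ↔ FactorsThroughPower C (corner f) := by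
  constructor
  · intro hf
    rw [← cornerHom_eq_zero_iff, ← TwoSidedIdeal.mem_ker]
    refine TwoSidedIdeal.mem_span_iff.1 hf _ (Set.singleton_subset_iff.2 ?_)
    rw [SetLike.mem_coe, TwoSidedIdeal.mem_ker, cornerHom_eq_zero_iff]
    convert FactorsThroughPower.zero
    ext x
    simp [corner, projC]
  · intro hf
    have he : projC Λ G C ∈ TwoSidedIdeal.span {projC Λ G C} := TwoSidedIdeal.subset_span rfl
    have key : f = (LinearMap.inl Λ G C).comp ((corner f).comp (LinearMap.fst Λ G C)) +
        projC Λ G C * f + (1 - projC Λ G C) * f * projC Λ G C := by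
      refine LinearMap.ext fun x => ?_
      have hx : f x = f (x.1, 0) + f (0, x.2) := by simp [← map_add]
      ext <;> simp [corner, projC, hx]
    rw [key]
    exact add_mem (add_mem (inl_comp_comp_fst_mem_span hf) (TwoSidedIdeal.mul_mem_right _ _ _ he))
      (TwoSidedIdeal.mul_mem_left _ _ _ he)

lemma span_projC_ringCon_eq_ker :
    (TwoSidedIdeal.span {projC Λ G C}).ringCon = RingCon.ker (cornerHom Λ G C) := by
  ext f g
  rw [TwoSidedIdeal.rel_iff, mem_span_projC_iff, ← cornerHom_eq_zero_iff, map_sub, sub_eq_zero,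
    RingCon.ker_apply]

lemma cornerHom_surjective : Function.Surjective (cornerHom Λ G C) := by
  intro y
  obtain ⟨g, rfl⟩ := RingCon.mk'_surjective _ y
  exact ⟨(LinearMap.inl Λ G C).comp (g.comp (LinearMap.fst Λ G C)), rfl⟩

variable (Λ G C)

/-- The isomorphism `End (G × C) / (e) ≃ End G / I` induced by the corner map. -/
noncomputable def cornerEquiv :
    (TwoSidedIdeal.span {projC Λ G C}).ringCon.Quotient ≃+*
      (factorIdeal Λ G C).ringCon.Quotient :=
  .ofBijective (RingCon.lift _ (cornerHom Λ G C) span_projC_ringCon_eq_ker.le)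
    (RingCon.lift_bijective_iff.2 ⟨span_projC_ringCon_eq_ker, cornerHom_surjective⟩)

end


/-- Proposition 1, algebraic core: for `E = End_Λ(G × C)` and `e` the projection onto `C`,
the set `I` of endomorphisms of `G` factoring through a finite power of `C` is a two-sided
ideal, and `f ↦ π_G ∘ f ∘ ι_G` induces a `k`-algebra isomorphism
`E/(e) ≅ End_Λ(G)/I`. -/
theorem stmt_10 (k : Type*) [Field k] (Λ : Type*) [Ring Λ] [Algebra k Λ]
    (G : Type*) [AddCommGroup G] [Module Λ G] [Module k G] [IsScalarTower k Λ G]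
    [SMulCommClass Λ k G]
    (C : Type*) [AddCommGroup C] [Module Λ C] [Module k C] [IsScalarTower k Λ C]
    [SMulCommClass Λ k C] :
    let E := Module.End Λ (G × C)
    let e : E := (LinearMap.inr Λ G C).comp (LinearMap.snd Λ G C)
    let I : Set (Module.End Λ G) := {f | ∃ (n : ℕ) (h : G →ₗ[Λ] (Fin n → C))
      (g' : (Fin n → C) →ₗ[Λ] G), f = g'.comp h}
    let ιG : G →ₗ[Λ] G × C := LinearMap.inl Λ G C
    let πG : G × C →ₗ[Λ] G := LinearMap.fst Λ G C
    ∃ J : TwoSidedIdeal (Module.End Λ G), (J : Set (Module.End Λ G)) = I ∧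
      ∃ ψ : (TwoSidedIdeal.span {e}).ringCon.Quotient ≃+* J.ringCon.Quotient,
        (∀ f : E, ψ (f : (TwoSidedIdeal.span {e}).ringCon.Quotient) =
          ((πG.comp (f.comp ιG) : Module.End Λ G) : J.ringCon.Quotient)) ∧
        (∀ (c : k) (f : E),
          ψ ((c • f : E) : (TwoSidedIdeal.span {e}).ringCon.Quotient) =
          ((c • (πG.comp (f.comp ιG)) : Module.End Λ G) : J.ringCon.Quotient)) := by
  intro E e I ιG πG
  exact ⟨factorIdeal Λ G C, Set.ext fun _ => mem_factorIdeal, cornerEquiv Λ G C,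
    fun _ => rfl, fun _ _ => rfl⟩
end

section
/- Let k be a field, Λ a k-algebra, and G, C, Y Λ-modules. Set D = G × C, let E = End_Λ(D), let e ∈ E be the projection (g, c) ↦ (0, c), and let ι_G : G → D be the inclusion g ↦ (g, 0). Then the additive subgroup of Hom_Λ(D, Y) generated by the set {f ∘ e ∘ r : f ∈ Hom_Λ(D, Y), r ∈ E} is equal to the set of all Λ-linear maps g : D → Y such that g ∘ ι_G : G → Y factors through a finite power of C (i.e. there exist n ∈ ℕ and Λ-linear maps h : G → Cⁿ, g′ : Cⁿ → Y with g ∘ ι_G = g′ ∘ h). -/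
/-- A map that factors through `C` factors through a finite power of `C`. -/
theorem factorsThroughPower_comp {Λ G C Y : Type*} [Ring Λ] [AddCommGroup G] [Module Λ G]
    [AddCommGroup C] [Module Λ C] [AddCommGroup Y] [Module Λ Y]
    (a : G →ₗ[Λ] C) (b : C →ₗ[Λ] Y) :
    ∃ (n : ℕ) (h : G →ₗ[Λ] (Fin n → C)) (g' : (Fin n → C) →ₗ[Λ] Y), b ∘ₗ a = g' ∘ₗ h :=
  ⟨1, LinearMap.pi fun _ => a, b ∘ₗ LinearMap.proj 0, rfl⟩

/-- Maps that factor through a finite power of `C` are closed under addition. -/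
theorem factorsThroughPower_add {Λ G C Y : Type*} [Ring Λ] [AddCommGroup G] [Module Λ G]
    [AddCommGroup C] [Module Λ C] [AddCommGroup Y] [Module Λ Y] {φ ψ : G →ₗ[Λ] Y}
    (hφ : ∃ (n : ℕ) (h : G →ₗ[Λ] (Fin n → C)) (g' : (Fin n → C) →ₗ[Λ] Y), φ = g' ∘ₗ h)
    (hψ : ∃ (n : ℕ) (h : G →ₗ[Λ] (Fin n → C)) (g' : (Fin n → C) →ₗ[Λ] Y), ψ = g' ∘ₗ h) :
    ∃ (n : ℕ) (h : G →ₗ[Λ] (Fin n → C)) (g' : (Fin n → C) →ₗ[Λ] Y), φ + ψ = g' ∘ₗ h := by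
  obtain ⟨m, h₁, g₁, rfl⟩ := hφ
  obtain ⟨n, h₂, g₂, rfl⟩ := hψ
  let split : (Fin (m + n) → C) ≃ₗ[Λ] (Fin m → C) × (Fin n → C) :=
    LinearEquiv.funCongrLeft Λ C finSumFinEquiv ≪≫ₗ
      LinearEquiv.sumArrowLequivProdArrow (Fin m) (Fin n) Λ C
  refine ⟨m + n, split.symm ∘ₗ h₁.prod h₂, g₁.coprod g₂ ∘ₗ split, ?_⟩
  ext x
  simp


/-- Computation of `ReN` in the proof of Proposition 1: for `D = G × C`, `E = End_Λ(D)` and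
`e ∈ E` the projection onto `C`, the additive subgroup of `Hom_Λ(D, Y)` generated by
`{f ∘ e ∘ r}` consists exactly of the maps `g : D → Y` such that `g ∘ ι_G` factors through a
finite power of `C`. -/
theorem stmt_11 (k : Type*) [Field k] (Λ : Type*) [Ring Λ] [Algebra k Λ]
    (G : Type*) [AddCommGroup G] [Module Λ G]
    (C : Type*) [AddCommGroup C] [Module Λ C]
    (Y : Type*) [AddCommGroup Y] [Module Λ Y] :
    let E := Module.End Λ (G × C)
    let e : E := (LinearMap.inr Λ G C).comp (LinearMap.snd Λ G C)
    let ιG : G →ₗ[Λ] G × C := LinearMap.inl Λ G C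
    (AddSubgroup.closure {x : (G × C) →ₗ[Λ] Y |
        ∃ (f : (G × C) →ₗ[Λ] Y) (r : E), x = f.comp (e.comp r)} : Set ((G × C) →ₗ[Λ] Y)) =
      {g : (G × C) →ₗ[Λ] Y | ∃ (n : ℕ) (h : G →ₗ[Λ] (Fin n → C))
        (g' : (Fin n → C) →ₗ[Λ] Y), g.comp ιG = g'.comp h} := by
  intro E e ιG
  ext g
  constructor
  · intro hg
    induction hg using AddSubgroup.closure_induction with
    | mem x hx =>
      obtain ⟨f, r, rfl⟩ := hx
      exact factorsThroughPower_comp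
        (LinearMap.snd Λ G C ∘ₗ r ∘ₗ ιG) (f ∘ₗ LinearMap.inr Λ G C)
    | zero => exact ⟨0, 0, 0, rfl⟩
    | add x y _ _ hx hy => exact factorsThroughPower_add hx hy
    | neg x _ hx =>
      obtain ⟨n, h, g', hx⟩ := hx
      exact ⟨n, h, -g', by rw [LinearMap.neg_comp, LinearMap.neg_comp, hx]⟩
  · rintro ⟨n, h, g', hg⟩
    have hdecomp : g = g ∘ₗ e ∘ₗ LinearMap.id +
        ∑ i, (g' ∘ₗ LinearMap.single Λ (fun _ : Fin n => C) i ∘ₗ LinearMap.snd Λ G C) ∘ₗ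
          (e ∘ₗ (LinearMap.inr Λ G C ∘ₗ LinearMap.proj i ∘ₗ h ∘ₗ LinearMap.fst Λ G C)) := by
      refine LinearMap.prod_ext ?_ ?_
      · rw [show g ∘ₗ LinearMap.inl Λ G C = g' ∘ₗ h from hg]
        ext x
        simp [e, ← map_sum, Finset.univ_sum_single]
        exact map_zero g
      · ext x
        simp [e]
    rw [hdecomp]
    exact add_mem (AddSubgroup.subset_closure ⟨_, _, rfl⟩)
      (sum_mem fun i _ => AddSubgroup.subset_closure ⟨_, _, rfl⟩)
end
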